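/- arXiv:hep-th/0408238 — 2 statements merged into one kernel-verified Lean document; each statement's English description precedes it below -/
import Mathlib

section
/- Proposition 2 (BCD-type reduction of WDVV): Let N ≥ 2, fix η ≥ 0 (with (η,ζ) as for the B, C or D root system), let U ⊆ ℝ^N be open, and let G : U → ℝ be a smooth function whose Hessian entries T_ij = ∂²G/∂z_i∂z_j satisfy, at every point of U, the BCD-type reduction: T_ij ≠ 0 and coth(T_ij/2) > 0 for i ≠ j; coth(T_ik/2) = coth(T_ij/2)·coth(T_jk/2) for all i < j < k; and e^{T_ii − T_jj} = [coth(T_ij/2)]^{2η+N−2} · (∏_{n≠j} sinh(T_jn))/(∏_{m≠i} sinh(T_im)) for all i < j. Then G satisfies the generalized WDVV equations on U: for every z ∈ U and all indices i, j, k with G_k(z) invertible, G_i(z)·G_k(z)^{−1}·G_j(z) = G_j(z)·G_k(z)^{−1}·G_i(z), where (G_m(z))_{rs} = ∂³G/∂z_m∂z_r∂z_s(z). -/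
open Real Finset

/-- Partial derivative in the `i`-th coordinate direction. -/
noncomputable def pd {N : ℕ} (i : Fin N) (f : (Fin N → ℝ) → ℝ) : (Fin N → ℝ) → ℝ :=
  fun x => fderiv ℝ f x (Pi.single i 1)

/-- Hessian entry `T_ij = ∂²f/∂x_i∂x_j`. -/
noncomputable def hess {N : ℕ} (f : (Fin N → ℝ) → ℝ) (i j : Fin N) : (Fin N → ℝ) → ℝ :=
  pd i (pd j f)

/-- The open cone `x₁ > x₂ > ⋯ > x_N > 0`. -/
def cone (N : ℕ) : Set (Fin N → ℝ) := {x | StrictAnti x ∧ ∀ i, 0 < x i}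

/-- The hyperbolic cotangent. -/
noncomputable def coth (t : ℝ) : ℝ := Real.cosh t / Real.sinh t

/-- The BCD-type reduction with parameter `η`: a second order system on the
Hessian entries `T_ij` (with `T_ij ≠ 0` and `coth (T_ij/2) > 0` off the diagonal). -/
def bcdReduction {N : ℕ} (η : ℝ) (T : Fin N → Fin N → ℝ) : Prop :=
  (∀ i j : Fin N, i ≠ j → T i j ≠ 0 ∧ 0 < coth (T i j / 2)) ∧
  (∀ i j k : Fin N, i < j → j < k →
      coth (T i k / 2) = coth (T i j / 2) * coth (T j k / 2)) ∧
  (∀ i j : Fin N, i < j →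
      Real.exp (T i i - T j j) =
        (coth (T i j / 2)) ^ (2*η + (N : ℝ) - 2) *
          ((∏ n ∈ Finset.univ.erase j, Real.sinh (T j n)) /
            (∏ m ∈ Finset.univ.erase i, Real.sinh (T i m))))

/-- `(G_m(z))_{rs} = ∂³G/∂z_m∂z_r∂z_s(z)`, the matrices of third derivatives. -/
noncomputable def thirdDeriv {N : ℕ} (G : (Fin N → ℝ) → ℝ) (m : Fin N)
    (z : Fin N → ℝ) : Matrix (Fin N) (Fin N) ℝ :=
  Matrix.of fun r s => pd m (pd r (pd s G)) z

open Matrix Filter Topology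

/-- The divided difference `(u i - u j) / (x i ^ 2 - x j ^ 2)`. -/
noncomputable def divDiff {N : ℕ} (x u : Fin N → ℝ) (i j : Fin N) : ℝ :=
  (u i - u j) / (x i ^ 2 - x j ^ 2)

/-- Third derivatives of the BCD prepotential at `x`, contracted with the vector
with coordinates `x i * u i`, up to normalization. -/
noncomputable def bcdMatrix {N : ℕ} (κ : ℝ) (x u : Fin N → ℝ) : Matrix (Fin N) (Fin N) ℝ :=
  diagonal (fun i => κ * u i + ∑ m, x m ^ 2 * divDiff x u i m) -
    of fun i j => x i * x j * divDiff x u i j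

lemma divDiff_self {N : ℕ} (x u : Fin N → ℝ) (i : Fin N) : divDiff x u i i = 0 := by
  simp [divDiff]

lemma divDiff_comm {N : ℕ} (x u : Fin N → ℝ) (i j : Fin N) :
    divDiff x u i j = divDiff x u j i := by
  rw [divDiff, divDiff, ← neg_sub (u j), ← neg_sub (x j ^ 2), neg_div_neg_eq]

lemma divDiff_cross {N : ℕ} {x : Fin N → ℝ} (hx : ∀ i j, i ≠ j → x i ^ 2 - x j ^ 2 ≠ 0)
    (u v : Fin N → ℝ) (i j k : Fin N) :
    divDiff x u i j * divDiff x v j k - divDiff x v i j * divDiff x u j k =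
      (divDiff x u i j - divDiff x u k j) * divDiff x v i k -
        (divDiff x v i j - divDiff x v k j) * divDiff x u i k := by
  rcases eq_or_ne i j with rfl | hij
  · rw [divDiff_comm x u k i, divDiff_comm x v k i, divDiff_self, divDiff_self]; ring
  rcases eq_or_ne j k with rfl | hjk
  · rw [divDiff_self, divDiff_self]; ring
  rcases eq_or_ne i k with rfl | hik
  · rw [divDiff_comm x u j i, divDiff_comm x v j i, divDiff_self, divDiff_self]; ring
  rw [divDiff_comm x u k j, divDiff_comm x v k j]
  have h1 := hx i j hij
  have h2 := hx j k hjk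
  have h3 := hx i k hik
  simp only [divDiff]
  field_simp
  ring

lemma commute_bcdMatrix {N : ℕ} (κ : ℝ) {x : Fin N → ℝ}
    (hx : ∀ i j, i ≠ j → x i ^ 2 - x j ^ 2 ≠ 0) (u v : Fin N → ℝ) :
    Commute (bcdMatrix κ x u) (bcdMatrix κ x v) := by
  rw [Commute, SemiconjBy, ← sub_eq_zero]
  ext i k
  have hsum : ∑ j, x i * x k * x j ^ 2 *
      (divDiff x u i j * divDiff x v j k - divDiff x v i j * divDiff x u j k) =
      ∑ j, x i * x k * x j ^ 2 *
      ((divDiff x u i j - divDiff x u k j) * divDiff x v i k -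
        (divDiff x v i j - divDiff x v k j) * divDiff x u i k) :=
    sum_congr rfl fun j _ => by rw [divDiff_cross hx]
  have hleft : ∑ j, x i * x k * x j ^ 2 *
      (divDiff x u i j * divDiff x v j k - divDiff x v i j * divDiff x u j k) =
      ∑ j, x i * x j * divDiff x u i j * (x j * x k * divDiff x v j k) -
      ∑ j, x i * x j * divDiff x v i j * (x j * x k * divDiff x u j k) := by
    rw [← sum_sub_distrib]
    exact sum_congr rfl fun j _ => by ring
  have hright : ∑ j, x i * x k * x j ^ 2 *
      ((divDiff x u i j - divDiff x u k j) * divDiff x v i k -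
        (divDiff x v i j - divDiff x v k j) * divDiff x u i k) =
      x i * x k * ((∑ j, x j ^ 2 * divDiff x u i j - ∑ j, x j ^ 2 * divDiff x u k j) *
        divDiff x v i k - (∑ j, x j ^ 2 * divDiff x v i j - ∑ j, x j ^ 2 * divDiff x v k j) *
        divDiff x u i k) := by
    rw [← sum_sub_distrib, ← sum_sub_distrib, sum_mul, sum_mul, ← sum_sub_distrib, mul_sum]
    exact sum_congr rfl fun j _ => by ring
  have hκ : (u i - u k) * divDiff x v i k = (v i - v k) * divDiff x u i k := by
    simp only [divDiff]; ring
  rw [hleft, hright] at hsum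
  have hdiag : diagonal (fun i => κ * u i + ∑ m, x m ^ 2 * divDiff x u i m) *
      diagonal (fun i => κ * v i + ∑ m, x m ^ 2 * divDiff x v i m) =
      diagonal (fun i => κ * v i + ∑ m, x m ^ 2 * divDiff x v i m) *
      diagonal (fun i => κ * u i + ∑ m, x m ^ 2 * divDiff x u i m) := by
    simp only [diagonal_mul_diagonal, mul_comm]
  simp only [bcdMatrix, sub_mul, mul_sub, hdiag]
  simp only [Matrix.sub_apply, diagonal_mul, mul_diagonal, of_apply, Matrix.zero_apply]
  rw [Matrix.mul_apply, Matrix.mul_apply]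
  simp only [of_apply]
  linear_combination hsum - x i * x k * κ * hκ

lemma one_lt_coth {t : ℝ} (ht : 0 < t) : 1 < coth t := by
  rw [coth, one_lt_div (sinh_pos_iff.2 ht)]
  exact sinh_lt_cosh t

lemma pos_of_coth_pos {t : ℝ} (h : 0 < coth t) : 0 < t := by
  by_contra! ht
  exact h.not_ge (div_nonpos_of_nonneg_of_nonpos (cosh_pos t).le (sinh_nonpos_iff.2 ht))

lemma hasDerivAt_log_coth_half {t : ℝ} (ht : 0 < t) :
    HasDerivAt (fun s => log (coth (s / 2))) (-(sinh t)⁻¹) t := by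
  have hs : 0 < sinh (t / 2) := sinh_pos_iff.2 (by linarith)
  have hc := cosh_pos (t / 2)
  have hd : HasDerivAt (fun s : ℝ => s / 2) (1 / 2) t := (hasDerivAt_id t).div_const 2
  have h := (hd.cosh.div hd.sinh hs.ne').log (div_pos hc hs).ne'
  refine h.congr_deriv ?_
  have ht2 : sinh t = 2 * sinh (t / 2) * cosh (t / 2) := by
    rw [← sinh_two_mul]; ring_nf
  rw [ht2]
  have := cosh_sq (t / 2)
  field_simp
  simp only [Pi.div_apply]
  field_simp
  linear_combination -this

lemma sinh_of_coth_half_eq_div {t a b : ℝ} (ht : 0 < t) (hb : 0 < b) (h : coth (t / 2) = a / b) :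
    sinh t = 2 * a * b / (a ^ 2 - b ^ 2) ∧ cosh t = (a ^ 2 + b ^ 2) / (a ^ 2 - b ^ 2) := by
  have hs : 0 < sinh (t / 2) := sinh_pos_iff.2 (by linarith)
  have hab : b < a := by
    have := one_lt_coth (half_pos ht)
    rwa [h, one_lt_div hb] at this
  have hD : a ^ 2 - b ^ 2 ≠ 0 := by nlinarith
  rw [coth, div_eq_div_iff hs.ne' hb.ne'] at h
  have hsq := cosh_sq (t / 2)
  have hs2 : sinh t = 2 * sinh (t / 2) * cosh (t / 2) := by
    rw [← sinh_two_mul]; ring_nf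
  have hc2 : cosh t = cosh (t / 2) ^ 2 + sinh (t / 2) ^ 2 := by
    rw [← cosh_two_mul]; ring_nf
  have hS : sinh (t / 2) ^ 2 * (a ^ 2 - b ^ 2) = b ^ 2 := by
    linear_combination (-(a * sinh (t / 2)) - cosh (t / 2) * b) * h + b ^ 2 * hsq
  have hC : cosh (t / 2) = a * sinh (t / 2) / b := by
    rw [eq_div_iff hb.ne', h]
  rw [hs2, hc2, hC, eq_div_iff hD, eq_div_iff hD]
  constructor
  · field_simp
    linear_combination a * hS
  · field_simp
    linear_combination hS

/-- Logarithmic coordinates attached to a solution of the reduction, normalized to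
vanish at the index `l`. -/
noncomputable def logCoord {N : ℕ} (l : Fin N) (T : Fin N → Fin N → ℝ) (i : Fin N) : ℝ :=
  if i = l then 0 else log (coth (T i l / 2))

section Reduction

variable {N : ℕ} {η : ℝ} {l : Fin N} {T : Fin N → Fin N → ℝ}

lemma bcdReduction.pos (h : bcdReduction η T) {i j : Fin N} (hij : i ≠ j) : 0 < T i j := by
  have := pos_of_coth_pos (h.1 i j hij).2
  linarith

lemma bcdReduction.log_coth (h : bcdReduction η T) (hl : ∀ i, i ≤ l) {i j : Fin N}
    (hij : i < j) : log (coth (T i j / 2)) = logCoord l T i - logCoord l T j := by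
  have hil : i ≠ l := (hij.trans_le (hl j)).ne
  rcases eq_or_ne j l with rfl | hjl
  · simp [logCoord, hil]
  · simp only [logCoord, hil, hjl, if_false]
    rw [h.2.1 i j l hij (lt_of_le_of_ne (hl j) hjl),
      log_mul (h.1 i j hij.ne).2.ne' (h.1 j l hjl).2.ne']
    ring

lemma bcdReduction.coth_eq_div (h : bcdReduction η T) (hl : ∀ i, i ≤ l) {i j : Fin N}
    (hij : i < j) : coth (T i j / 2) = exp (logCoord l T i) / exp (logCoord l T j) := by
  rw [← exp_sub, ← h.log_coth hl hij, exp_log (h.1 i j hij.ne).2]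

lemma bcdReduction.diag_sub (h : bcdReduction η T) (hl : ∀ i, i ≤ l) {i j : Fin N}
    (hij : i < j) : T i i - T j j =
      (2 * η + (N : ℝ) - 2) * (logCoord l T i - logCoord l T j) +
        (∑ n ∈ univ.erase j, log (sinh (T j n)) - ∑ m ∈ univ.erase i, log (sinh (T i m))) := by
  have hs : ∀ k, ∀ m ∈ univ.erase k, sinh (T k m) ≠ 0 := fun k m hm =>
    (sinh_pos_iff.2 (h.pos (ne_of_mem_erase hm).symm)).ne'
  have hc := (h.1 i j hij.ne).2
  rw [← log_exp (T i i - T j j), h.2.2 i j hij,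
    log_mul (rpow_pos_of_pos hc _).ne'
      (div_ne_zero (prod_ne_zero_iff.2 (hs j)) (prod_ne_zero_iff.2 (hs i))),
    log_rpow hc, h.log_coth hl hij,
    log_div (prod_ne_zero_iff.2 (hs j)) (prod_ne_zero_iff.2 (hs i)),
    log_prod (hs j), log_prod (hs i)]

lemma bcdReduction.sinh_cosh (h : bcdReduction η T) (hl : ∀ i, i ≤ l) {i j : Fin N}
    (hij : i < j) :
    sinh (T i j) = 2 * exp (logCoord l T i) * exp (logCoord l T j) /
        (exp (logCoord l T i) ^ 2 - exp (logCoord l T j) ^ 2) ∧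
      cosh (T i j) = (exp (logCoord l T i) ^ 2 + exp (logCoord l T j) ^ 2) /
        (exp (logCoord l T i) ^ 2 - exp (logCoord l T j) ^ 2) :=
  sinh_of_coth_half_eq_div (h.pos hij.ne) (exp_pos _) (h.coth_eq_div hl hij)

lemma bcdReduction.sq_sub_sq_ne_zero (h : bcdReduction η T) (hl : ∀ i, i ≤ l) (i j : Fin N)
    (hij : i ≠ j) : exp (logCoord l T i) ^ 2 - exp (logCoord l T j) ^ 2 ≠ 0 := by
  have hlt : ∀ i j : Fin N, i < j → exp (logCoord l T j) < exp (logCoord l T i) := by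
    intro i j hij
    have := one_lt_coth (half_pos (h.pos hij.ne))
    rwa [h.coth_eq_div hl hij, one_lt_div (exp_pos _)] at this
  have hi := exp_pos (logCoord l T i)
  have hj := exp_pos (logCoord l T j)
  rcases hij.lt_or_gt with h' | h'
  · have := hlt _ _ h'; nlinarith
  · have := hlt _ _ h'; nlinarith

end Reduction

/-- The velocity of a curve of solutions of the reduction. -/
lemma exists_eq_bcdMatrix_of_hasDerivAt {N : ℕ} {η : ℝ} {l : Fin N} (hl : ∀ i, i ≤ l)
    {τ : ℝ → Fin N → Fin N → ℝ} {A : Matrix (Fin N) (Fin N) ℝ} {s₀ : ℝ}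
    (hA : ∀ i j, HasDerivAt (fun s => τ s i j) (A i j) s₀)
    (hred : ∀ᶠ s in 𝓝 s₀, bcdReduction η (τ s))
    (hsymm : ∀ᶠ s in 𝓝 s₀, ∀ i j, τ s i j = τ s j i) :
    ∃ (u : Fin N → ℝ) (c : ℝ),
      A = bcdMatrix (η + N - 1) (fun i => exp (logCoord l (τ s₀) i)) u + c • 1 := by
  have h₀ := hred.self_of_nhds
  obtain ⟨d, hd⟩ : ∃ d : Fin N → ℝ, ∀ i, HasDerivAt (fun s => logCoord l (τ s) i) (d i) s₀ := by
    refine ⟨fun i => if i = l then 0 else -(sinh (τ s₀ i l))⁻¹ * A i l, fun i => ?_⟩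
    by_cases hi : i = l
    · simpa [logCoord, hi] using hasDerivAt_const s₀ (0 : ℝ)
    · simp only [logCoord, hi, if_false]
      exact (hasDerivAt_log_coth_half (h₀.pos hi)).comp s₀ (hA i l)
  have hAsymm : ∀ i j, A i j = A j i := fun i j =>
    (hA i j).unique ((hA j i).congr_of_eventuallyEq (hsymm.mono fun s hs => hs i j))
  have hτsymm := hsymm.self_of_nhds
  have hoff_lt : ∀ i j, i < j → A i j = -sinh (τ s₀ i j) * (d i - d j) := by
    intro i j hij
    have h1 := (hasDerivAt_log_coth_half (h₀.pos hij.ne)).comp s₀ (hA i j)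
    have h2 := h1.unique (((hd i).sub (hd j)).congr_of_eventuallyEq
      (hred.mono fun s hs => hs.log_coth hl hij))
    have := (sinh_pos_iff.2 (h₀.pos hij.ne)).ne'
    rw [← h2]
    field_simp
  set x : Fin N → ℝ := fun i => exp (logCoord l (τ s₀) i) with hx
  have hxne : ∀ i j, i ≠ j → x i ^ 2 - x j ^ 2 ≠ 0 := h₀.sq_sub_sq_ne_zero hl
  have hoff : ∀ i j, i ≠ j → A i j = -(x i * x j * divDiff x (fun i => 2 * d i) i j) := by
    have key : ∀ i j, i < j → A i j = -(x i * x j * divDiff x (fun i => 2 * d i) i j) := by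
      intro i j hij
      rw [hoff_lt i j hij, (h₀.sinh_cosh hl hij).1]
      simp only [divDiff, hx]
      ring
    intro i j hij
    rcases hij.lt_or_gt with h | h
    · exact key i j h
    · rw [hAsymm, key j i h, divDiff_comm]; ring
  have hcoth : ∀ i j, i ≠ j → cosh (τ s₀ i j) / sinh (τ s₀ i j) * A i j =
      -(d i - d j) - x j ^ 2 * divDiff x (fun i => 2 * d i) i j := by
    have key : ∀ i j, i < j → cosh (τ s₀ i j) / sinh (τ s₀ i j) * A i j =
        -((d i - d j) * ((x i ^ 2 + x j ^ 2) / (x i ^ 2 - x j ^ 2))) := by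
      intro i j hij
      have hs := (sinh_pos_iff.2 (h₀.pos hij.ne)).ne'
      rw [hoff_lt i j hij, ← (h₀.sinh_cosh hl hij).2]
      field_simp
    intro i j hij
    have hD := hxne i j hij
    have hfin : -((d i - d j) * ((x i ^ 2 + x j ^ 2) / (x i ^ 2 - x j ^ 2))) =
        -(d i - d j) - x j ^ 2 * divDiff x (fun i => 2 * d i) i j := by
      simp only [divDiff]
      field_simp
      ring
    rw [← hfin]
    rcases hij.lt_or_gt with h | h
    · exact key i j h
    · rw [hAsymm, hτsymm i j, key j i h, ← neg_sub (x i ^ 2), div_neg, add_comm (x j ^ 2)]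
      ring
  have hlogsinh : ∀ i, HasDerivAt (fun s => ∑ m ∈ univ.erase i, log (sinh (τ s i m)))
      (-(N * d i) + ∑ m, d m - ∑ m, x m ^ 2 * divDiff x (fun i => 2 * d i) i m) s₀ := by
    intro i
    have h1 : HasDerivAt (fun s => ∑ m ∈ univ.erase i, log (sinh (τ s i m)))
        (∑ m ∈ univ.erase i, cosh (τ s₀ i m) * A i m / sinh (τ s₀ i m)) s₀ := by
      refine HasDerivAt.fun_sum fun m hm => ?_
      exact (hA i m).sinh.log (sinh_pos_iff.2 (h₀.pos (ne_of_mem_erase hm).symm)).ne'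
    refine h1.congr_deriv ?_
    have h2 : ∑ m ∈ univ.erase i, cosh (τ s₀ i m) * A i m / sinh (τ s₀ i m) =
        ∑ m ∈ univ.erase i, (-(d i - d m) - x m ^ 2 * divDiff x (fun i => 2 * d i) i m) :=
      sum_congr rfl fun m hm => by
        rw [← hcoth i m (ne_of_mem_erase hm).symm]; ring
    rw [h2, sum_erase _ (by simp [divDiff_self])]
    simp [sum_sub_distrib]
    ring
  have hdiag_lt : ∀ i j, i < j →
      A i i - ((η + N - 1) * (2 * d i) + ∑ m, x m ^ 2 * divDiff x (fun i => 2 * d i) i m) =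
      A j j - ((η + N - 1) * (2 * d j) + ∑ m, x m ^ 2 * divDiff x (fun i => 2 * d i) j m) := by
    intro i j hij
    have h1 := ((hA i i).sub (hA j j)).unique
      (((((hd i).sub (hd j)).const_mul (2 * η + (N : ℝ) - 2)).add
        ((hlogsinh j).sub (hlogsinh i))).congr_of_eventuallyEq
        (hred.mono fun s hs => hs.diag_sub hl hij))
    linear_combination h1
  refine ⟨fun i => 2 * d i, A l l - ((η + N - 1) * (2 * d l) +
    ∑ m, x m ^ 2 * divDiff x (fun i => 2 * d i) l m), ?_⟩
  ext i j
  rcases eq_or_ne i j with rfl | hij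
  · have : A i i - ((η + N - 1) * (2 * d i) +
        ∑ m, x m ^ 2 * divDiff x (fun i => 2 * d i) i m) = A l l - ((η + N - 1) * (2 * d l) +
        ∑ m, x m ^ 2 * divDiff x (fun i => 2 * d i) l m) := by
      rcases (hl i).eq_or_lt with rfl | h
      · rfl
      · exact hdiag_lt i l h
    simp only [bcdMatrix, Matrix.add_apply, Matrix.sub_apply, diagonal_apply_eq, of_apply,
      divDiff_self, Matrix.smul_apply, one_apply_eq, smul_eq_mul]
    linear_combination this
  · rw [hoff i j hij]
    simp [bcdMatrix, hij]

section Smooth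

variable {N : ℕ} {U : Set (Fin N → ℝ)} {f : (Fin N → ℝ) → ℝ}

lemma ContDiffOn.pd (hU : IsOpen U) (hf : ContDiffOn ℝ (⊤ : ℕ∞) f U) (i : Fin N) :
    ContDiffOn ℝ (⊤ : ℕ∞) (pd i f) U :=
  (hf.fderiv_of_isOpen hU (by simp)).clm_apply contDiffOn_const

lemma hess_comm (hU : IsOpen U) (hf : ContDiffOn ℝ (⊤ : ℕ∞) f U) {z : Fin N → ℝ} (hz : z ∈ U)
    (i j : Fin N) : hess f i j z = hess f j i z := by
  have hdiff : DifferentiableAt ℝ (fderiv ℝ f) z :=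
    ((hf.fderiv_of_isOpen (m := (⊤ : ℕ∞)) hU (by simp)).contDiffAt
      (hU.mem_nhds hz)).differentiableAt (by simp)
  have hh : ∀ i j : Fin N, hess f i j z =
      fderiv ℝ (fderiv ℝ f) z (Pi.single i 1) (Pi.single j 1) := by
    intro i j
    change fderiv ℝ (fun y => fderiv ℝ f y (Pi.single j 1)) z (Pi.single i 1) = _
    rw [fderiv_clm_apply hdiff (differentiableAt_const _)]
    simp
  rw [hh, hh]
  exact ((hf.contDiffAt (hU.mem_nhds hz)).isSymmSndFDerivAt
    (by simpa using WithTop.coe_le_coe.2 (le_top : (2 : ℕ∞) ≤ ⊤))).eq _ _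

lemma hasDerivAt_hess_line (hU : IsOpen U) (hf : ContDiffOn ℝ (⊤ : ℕ∞) f U) {z : Fin N → ℝ}
    (hz : z ∈ U) (m i j : Fin N) :
    HasDerivAt (fun s : ℝ => hess f i j (z + s • Pi.single m (1 : ℝ)))
      (thirdDeriv f m z i j) 0 := by
  have hdiff : DifferentiableAt ℝ (hess f i j) z :=
    (((hf.pd hU j).pd hU i).contDiffAt (hU.mem_nhds hz)).differentiableAt (by simp)
  exact hdiff.hasFDerivAt.hasLineDerivAt (Pi.single m 1)

end Smooth

lemma Commute.mul_inv_mul_eq {n : Type*} [Fintype n] [DecidableEq n] {A B K : Matrix n n ℝ}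
    (hAB : Commute A B) (hAK : Commute A K) (hBK : Commute B K) (hK : IsUnit K) :
    A * K⁻¹ * B = B * K⁻¹ * A := by
  obtain ⟨k, rfl⟩ := hK
  rw [← coe_units_inv, hAK.units_inv_right.eq, hBK.units_inv_right.eq, mul_assoc, mul_assoc,
    hAB.eq]

/-- Proposition 2: any smooth function on an open set whose Hessian
entries satisfy the BCD-type reduction (with parameter `η ≥ 0`) satisfies the
generalized WDVV equations. -/
theorem bcd_reduction_implies_WDVV (N : ℕ) (hN : 2 ≤ N) (η : ℝ) (hη : 0 ≤ η)
    (U : Set (Fin N → ℝ)) (hU : IsOpen U) (G : (Fin N → ℝ) → ℝ)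
    (hG : ContDiffOn ℝ (⊤ : ℕ∞) G U)
    (hred : ∀ z ∈ U, bcdReduction η (fun i j => hess G i j z)) :
    ∀ z ∈ U, ∀ i j k : Fin N, IsUnit (thirdDeriv G k z) →
      thirdDeriv G i z * (thirdDeriv G k z)⁻¹ * thirdDeriv G j z =
        thirdDeriv G j z * (thirdDeriv G k z)⁻¹ * thirdDeriv G i z := by
  intro z hz i j k hk
  let l : Fin N := ⟨N - 1, by omega⟩
  have hl : ∀ i : Fin N, i ≤ l := fun i => Fin.mk_le_mk.2 (by omega)
  have hform : ∀ m, ∃ (u : Fin N → ℝ) (c : ℝ), thirdDeriv G m z =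
      bcdMatrix (η + N - 1) (fun i => exp (logCoord l (fun i j => hess G i j z) i)) u + c • 1 := by
    intro m
    have hU' : ∀ᶠ s : ℝ in 𝓝 0, z + s • Pi.single m (1 : ℝ) ∈ U := by
      have hcont : Continuous fun s : ℝ => z + s • (Pi.single m (1 : ℝ) : Fin N → ℝ) := by
        fun_prop
      exact hcont.continuousAt.eventually_mem (hU.mem_nhds (by simpa using hz))
    have h := exists_eq_bcdMatrix_of_hasDerivAt hl
      (τ := fun s i j => hess G i j (z + s • Pi.single m (1 : ℝ)))
      (fun i j => hasDerivAt_hess_line hU hG hz m i j)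
      (hU'.mono fun s hs => hred _ hs) (hU'.mono fun s hs i j => hess_comm hU hG hs i j)
    simp only [zero_smul, add_zero] at h
    exact h
  have hcomm : ∀ m n, Commute (thirdDeriv G m z) (thirdDeriv G n z) := by
    intro m n
    obtain ⟨u, c, hm⟩ := hform m
    obtain ⟨v, c', hn⟩ := hform n
    rw [hm, hn]
    have hone : ∀ (c : ℝ) (B : Matrix (Fin N) (Fin N) ℝ), Commute (c • 1) B := fun c B =>
      (Commute.one_left B).smul_left c
    exact ((commute_bcdMatrix _ ((hred z hz).sq_sub_sq_ne_zero hl) u v).add_left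
      (hone c _)).add_right (hone c' _).symm
  exact (hcomm i j).mul_inv_mul_eq (hcomm i k) (hcomm j k) hk
end

section
/- Let N ≥ 3, let η ≥ 0 and ζ ∈ ℝ, let F be the BCD-type prepotential with parameters (η, ζ) and Λ = e^{(6(N−1+η)+4ζ)/(4(N−1+η))} on the cone C = {x ∈ ℝ^N : x_1 > ⋯ > x_N > 0}, and let Q(x) = ∑_{i,j} a_{ij} x_i x_j be a quadratic form with real symmetric coefficient matrix (a_{ij}). If the Hessian entries of F + Q satisfy the BCD-type reduction with parameter η at every point of C, then a_{ij} = 0 for all i ≠ j and there exists ξ ∈ ℝ with a_{ii} = ξ for all i; that is, Q(x) = ξ·∑_{i=1}^N x_i². (This is the real form of the paper's statement that such Q must be ∑_{i≠j} nπ√(−1) x_i x_j + ξ∑_i x_i² with n ∈ ℤ: over the reals only n = 0 is possible.) -/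
open Real Finset

/-- The BCD-type prepotential with parameters `η, ζ` and cut-off `Λ`. -/
noncomputable def FBCD (N : ℕ) (η ζ Λ : ℝ) (x : Fin N → ℝ) : ℝ :=
  (1/2) * ∑ i : Fin N, ∑ j : Fin N,
      (if i < j then (x i - x j)^2 * Real.log ((x i - x j)/Λ)
                      + (x i + x j)^2 * Real.log ((x i + x j)/Λ) else 0)
  + η * ∑ i : Fin N, (x i)^2 * Real.log (x i / Λ)
  + ζ * ∑ i : Fin N, (x i)^2

open Topology in
/-- `f` is twice differentiable at `x` (with `f` differentiable near `x`) and `H` is its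
second derivative there. -/
def HasHessAt {N : ℕ} (f : (Fin N → ℝ) → ℝ)
    (H : (Fin N → ℝ) →L[ℝ] (Fin N → ℝ) →L[ℝ] ℝ) (x : Fin N → ℝ) : Prop :=
  ∃ g : (Fin N → ℝ) → (Fin N → ℝ) →L[ℝ] ℝ,
    (∀ᶠ y in 𝓝 x, HasFDerivAt f (g y) y) ∧ HasFDerivAt g H x

namespace HasHessAt

variable {N : ℕ} {f₁ f₂ : (Fin N → ℝ) → ℝ}
  {H₁ H₂ : (Fin N → ℝ) →L[ℝ] (Fin N → ℝ) →L[ℝ] ℝ} {x : Fin N → ℝ}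

theorem hess_eq (h : HasHessAt f₁ H₁ x) (i j : Fin N) :
    hess f₁ i j x = H₁ (Pi.single i 1) (Pi.single j 1) := by
  obtain ⟨g, hg, hH⟩ := h
  have heq : pd j f₁ =ᶠ[nhds x] fun y => g y (Pi.single j 1) := by
    filter_upwards [hg] with y hy
    simp only [pd, hy.fderiv]
  have hd := hH.clm_apply (hasFDerivAt_const (Pi.single j (1 : ℝ)) x)
  rw [hess, pd, heq.fderiv_eq, hd.fderiv]
  simp

theorem add (h₁ : HasHessAt f₁ H₁ x) (h₂ : HasHessAt f₂ H₂ x) :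
    HasHessAt (fun y => f₁ y + f₂ y) (H₁ + H₂) x := by
  obtain ⟨g₁, hg₁, hH₁⟩ := h₁
  obtain ⟨g₂, hg₂, hH₂⟩ := h₂
  refine ⟨fun y => g₁ y + g₂ y, ?_, hH₁.add hH₂⟩
  filter_upwards [hg₁, hg₂] with y h₁ h₂ using h₁.add h₂

theorem const_mul (c : ℝ) (h : HasHessAt f₁ H₁ x) :
    HasHessAt (fun y => c * f₁ y) (c • H₁) x := by
  obtain ⟨g, hg, hH⟩ := h
  refine ⟨fun y => c • g y, ?_, hH.const_smul c⟩
  filter_upwards [hg] with y hy using hy.const_mul c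

theorem zero : HasHessAt (fun _ : Fin N → ℝ => (0 : ℝ)) 0 x :=
  ⟨fun _ => 0, Filter.Eventually.of_forall fun y => hasFDerivAt_const 0 y,
    hasFDerivAt_const 0 x⟩

theorem sum {ι : Type*} (s : Finset ι) {f : ι → (Fin N → ℝ) → ℝ}
    {H : ι → (Fin N → ℝ) →L[ℝ] (Fin N → ℝ) →L[ℝ] ℝ}
    (h : ∀ i ∈ s, HasHessAt (f i) (H i) x) :
    HasHessAt (fun y => ∑ i ∈ s, f i y) (∑ i ∈ s, H i) x := by
  classical
  induction s using Finset.induction_on with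
  | empty => simpa using zero
  | insert i s hi ih =>
    simp only [Finset.sum_insert hi]
    exact (h i (Finset.mem_insert_self i s)).add
      (ih fun k hk => h k (Finset.mem_insert_of_mem hk))

theorem mul_clm (p q : (Fin N → ℝ) →L[ℝ] ℝ) :
    HasHessAt (fun y => p y * q y) (p.smulRight q + q.smulRight p) x := by
  refine ⟨fun y => p y • q + q y • p, Filter.Eventually.of_forall fun y => ?_, ?_⟩
  · exact p.hasFDerivAt.mul q.hasFDerivAt
  · exact (p.smulRight q + q.smulRight p).hasFDerivAt

theorem sq_mul_log {Λ : ℝ} (hΛ : 0 < Λ) (L : (Fin N → ℝ) →L[ℝ] ℝ) (hL : 0 < L x) :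
    HasHessAt (fun y => (L y) ^ 2 * Real.log (L y / Λ))
      ((2 * Real.log (L x / Λ) + 3) • L.smulRight L) x := by
  refine ⟨fun y => (2 * L y * Real.log (L y / Λ) + L y) • L, ?_, ?_⟩
  · filter_upwards [L.continuous.continuousAt.eventually (lt_mem_nhds hL)] with y hy
    have h : HasDerivAt (fun t : ℝ => t ^ 2 * Real.log (t / Λ))
        (2 * L y * Real.log (L y / Λ) + L y) (L y) := by
      have h1 := (hasDerivAt_pow 2 (L y)).mul
        (((hasDerivAt_id (L y)).div_const Λ).log (div_pos hy hΛ).ne')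
      refine h1.congr_deriv ?_
      simp only [id]
      field_simp
      ring
    exact h.comp_hasFDerivAt y L.hasFDerivAt
  · have h : HasDerivAt (fun t : ℝ => 2 * t * Real.log (t / Λ) + t)
        (2 * Real.log (L x / Λ) + 3) (L x) := by
      have h1 := (((hasDerivAt_id (L x)).const_mul 2).mul
        (((hasDerivAt_id (L x)).div_const Λ).log (div_pos hL hΛ).ne')).add
          (hasDerivAt_id (L x))
      refine h1.congr_deriv ?_
      simp only [id]
      field_simp
      ring
    have h2 := (h.comp_hasFDerivAt x L.hasFDerivAt).smul_const L
    refine h2.congr_fderiv ?_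
    ext v w
    simp [mul_assoc]

end HasHessAt

/-- The second derivative of the BCD-type prepotential plus a quadratic form, as a bilinear form. -/
theorem hasHessAt_FBCD_add {N : ℕ} (η ζ : ℝ) {Λ : ℝ} (hΛ : 0 < Λ) (a : Fin N → Fin N → ℝ)
    {x : Fin N → ℝ} (hx : x ∈ cone N) :
    let e : Fin N → (Fin N → ℝ) →L[ℝ] ℝ := fun i => ContinuousLinearMap.proj i
    HasHessAt (fun w => FBCD N η ζ Λ w + ∑ p : Fin N, ∑ q : Fin N, a p q * w p * w q)
      (((1 / 2 : ℝ) • ∑ i : Fin N, ∑ j : Fin N,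
          (if i < j then
            (2 * Real.log ((x i - x j) / Λ) + 3) • (e i - e j).smulRight (e i - e j)
            + (2 * Real.log ((x i + x j) / Λ) + 3) • (e i + e j).smulRight (e i + e j)
          else 0)
        + η • ∑ i : Fin N, (2 * Real.log (x i / Λ) + 3) • (e i).smulRight (e i)
        + ζ • ∑ i : Fin N, ((e i).smulRight (e i) + (e i).smulRight (e i)))
        + ∑ p : Fin N, ∑ q : Fin N,
          a p q • ((e p).smulRight (e q) + (e q).smulRight (e p))) x := by
  intro e
  simp only [FBCD, mul_assoc (a _ _)]
  refine HasHessAt.add (HasHessAt.add (HasHessAt.add ?_ ?_) ?_) ?_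
  · refine HasHessAt.const_mul _ (.sum _ fun i _ => .sum _ fun j _ => ?_)
    split_ifs with hij
    · refine HasHessAt.add ?_ ?_
      · exact HasHessAt.sq_mul_log hΛ (e i - e j) (sub_pos.2 (hx.1 hij))
      · exact HasHessAt.sq_mul_log hΛ (e i + e j) (add_pos (hx.2 i) (hx.2 j))
    · exact .zero
  · exact HasHessAt.const_mul _ (.sum _ fun i _ => .sq_mul_log hΛ (e i) (hx.2 i))
  · simp only [sq]
    exact HasHessAt.const_mul _ (.sum _ fun i _ => .mul_clm (e i) (e i))
  · exact .sum _ fun p _ => .sum _ fun q _ => .const_mul _ (.mul_clm (e p) (e q))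

/-- The Hessian entries of the BCD-type prepotential plus a quadratic form, in terms of
Kronecker deltas. -/
theorem hess_FBCD_add {N : ℕ} (η ζ : ℝ) {Λ : ℝ} (hΛ : 0 < Λ) (a : Fin N → Fin N → ℝ)
    {x : Fin N → ℝ} (hx : x ∈ cone N) (k l : Fin N) :
    hess (fun w => FBCD N η ζ Λ w + ∑ p : Fin N, ∑ q : Fin N, a p q * w p * w q) k l x
      = 1 / 2 * (∑ i : Fin N, ∑ j : Fin N, if i < j then
          (2 * Real.log ((x i - x j) / Λ) + 3) *
            (((if i = k then 1 else 0) - (if j = k then 1 else 0)) *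
              ((if i = l then 1 else 0) - (if j = l then 1 else 0)))
          + (2 * Real.log ((x i + x j) / Λ) + 3) *
            (((if i = k then 1 else 0) + (if j = k then 1 else 0)) *
              ((if i = l then 1 else 0) + (if j = l then 1 else 0))) else 0)
        + η * ∑ i : Fin N, (2 * Real.log (x i / Λ) + 3) *
            ((if i = k then 1 else 0) * (if i = l then 1 else 0))
        + ζ * ∑ i : Fin N, ((if i = k then 1 else 0) * (if i = l then 1 else 0)
            + (if i = k then 1 else 0) * (if i = l then 1 else 0))
        + ∑ p : Fin N, ∑ q : Fin N, a p q *
          ((if p = k then 1 else 0) * (if q = l then 1 else 0)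
            + (if q = k then 1 else 0) * (if p = l then 1 else 0)) := by
  rw [(hasHessAt_FBCD_add η ζ hΛ a hx).hess_eq]
  simp only [add_apply, smul_apply, _root_.sum_apply, ContinuousLinearMap.smulRight_apply,
    smul_eq_mul, sub_apply, ContinuousLinearMap.proj_apply, zero_apply, Pi.single_apply,
    apply_ite (fun A : (Fin N → ℝ) →L[ℝ] (Fin N → ℝ) →L[ℝ] ℝ => A (Pi.single k 1) (Pi.single l 1))]

theorem sum_lt_delta_of_ne {N : ℕ} {A B : Fin N → Fin N → ℝ} (hA : ∀ i j, A j i = A i j)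
    (hB : ∀ i j, B j i = B i j) {k l : Fin N} (hkl : k ≠ l) :
    (∑ i : Fin N, ∑ j : Fin N, if i < j then
      A i j * (((if i = k then 1 else 0) - (if j = k then 1 else 0)) *
        ((if i = l then 1 else 0) - (if j = l then 1 else 0)))
      + B i j * (((if i = k then 1 else 0) + (if j = k then 1 else 0)) *
        ((if i = l then 1 else 0) + (if j = l then 1 else 0))) else 0) = B k l - A k l := by
  have key : ∀ p q : Fin N, p < q → (p = k ∧ q = l ∨ p = l ∧ q = k) →
      (∑ i : Fin N, ∑ j : Fin N, if i < j then
        A i j * (((if i = k then 1 else 0) - (if j = k then 1 else 0)) *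
          ((if i = l then 1 else 0) - (if j = l then 1 else 0)))
        + B i j * (((if i = k then 1 else 0) + (if j = k then 1 else 0)) *
          ((if i = l then 1 else 0) + (if j = l then 1 else 0))) else 0) = B k l - A k l := by
    intro p q hpq hor
    rw [Finset.sum_eq_single p, Finset.sum_eq_single q]
    · rw [if_pos hpq]
      rcases hor with ⟨rfl, rfl⟩ | ⟨rfl, rfl⟩
      · simp only [hkl, hkl.symm, if_true, if_false]
        ring
      · rw [hA p q, hB p q]
        simp only [hkl, hkl.symm, if_true, if_false]
        ring
    · grind
    · simp
    · intro i _ hi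
      refine Finset.sum_eq_zero fun j _ => ?_
      grind
    · simp
  rcases lt_or_gt_of_ne hkl with h | h
  · exact key k l h (by simp)
  · exact key l k h (by simp)

theorem sum_lt_delta_self {N : ℕ} {A B : Fin N → Fin N → ℝ} (hA : ∀ i j, A j i = A i j)
    (hB : ∀ i j, B j i = B i j) (k : Fin N) :
    (∑ i : Fin N, ∑ j : Fin N, if i < j then
      A i j * (((if i = k then 1 else 0) - (if j = k then 1 else 0)) *
        ((if i = k then 1 else 0) - (if j = k then 1 else 0)))
      + B i j * (((if i = k then 1 else 0) + (if j = k then 1 else 0)) *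
        ((if i = k then 1 else 0) + (if j = k then 1 else 0))) else 0)
      = ∑ m ∈ univ.erase k, (A k m + B k m) := by
  have hsplit : ∀ i j : Fin N, (if i < j then
      A i j * (((if i = k then 1 else 0) - (if j = k then 1 else 0)) *
        ((if i = k then 1 else 0) - (if j = k then 1 else 0)))
      + B i j * (((if i = k then 1 else 0) + (if j = k then 1 else 0)) *
        ((if i = k then 1 else 0) + (if j = k then 1 else 0))) else 0)
      = (if i = k then (if k < j then A k j + B k j else 0) else 0)
        + (if j = k then (if i < k then A k i + B k i else 0) else 0) := by
    intro i j
    have := hA i j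
    have := hB i j
    grind
  simp only [hsplit, Finset.sum_add_distrib, Finset.sum_ite_eq', Finset.mem_univ, if_true]
  rw [Finset.sum_comm]
  simp only [Finset.sum_ite_eq', Finset.mem_univ, if_true, ← Finset.sum_add_distrib]
  rw [← Finset.add_sum_erase _ _ (Finset.mem_univ k)]
  simp only [lt_irrefl, if_false, zero_add]
  refine Finset.sum_congr rfl fun m hm => ?_
  have := Finset.ne_of_mem_erase hm
  grind

theorem log_sub_div_comm (u v c : ℝ) : Real.log ((v - u) / c) = Real.log ((u - v) / c) := by
  rw [← Real.log_neg_eq_log, ← neg_div, neg_sub]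

theorem cone_sub_ne_zero {N : ℕ} {x : Fin N → ℝ} (hx : x ∈ cone N) {k l : Fin N} (hkl : k ≠ l) :
    x k - x l ≠ 0 :=
  sub_ne_zero.2 fun h => hkl (hx.1.injective h)

theorem cone_add_ne_zero {N : ℕ} {x : Fin N → ℝ} (hx : x ∈ cone N) (k l : Fin N) :
    x k + x l ≠ 0 :=
  (add_pos (hx.2 k) (hx.2 l)).ne'

theorem hess_FBCD_add_of_ne {N : ℕ} (η ζ : ℝ) {Λ : ℝ} (hΛ : 0 < Λ) {a : Fin N → Fin N → ℝ}
    (hsym : ∀ i j, a j i = a i j) {x : Fin N → ℝ} (hx : x ∈ cone N) {k l : Fin N} (hkl : k ≠ l) :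
    hess (fun w => FBCD N η ζ Λ w + ∑ p : Fin N, ∑ q : Fin N, a p q * w p * w q) k l x
      = Real.log ((x k + x l) / |x k - x l|) + 2 * a k l := by
  have hsub := cone_sub_ne_zero hx hkl
  have hadd := cone_add_ne_zero hx k l
  have hdelta : ∀ i : Fin N,
      (if i = k then (1 : ℝ) else 0) * (if i = l then 1 else 0) = 0 := by
    intro i
    grind
  rw [hess_FBCD_add η ζ hΛ a hx, sum_lt_delta_of_ne
    (A := fun i j => 2 * Real.log ((x i - x j) / Λ) + 3)
    (B := fun i j => 2 * Real.log ((x i + x j) / Λ) + 3)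
    (fun i j => by rw [log_sub_div_comm]) (fun i j => by rw [add_comm (x j)]) hkl,
    Real.log_div hadd (abs_ne_zero.2 hsub), Real.log_abs,
    Real.log_div hsub hΛ.ne', Real.log_div hadd hΛ.ne']
  simp [hdelta, mul_add, Finset.sum_add_distrib, hsym k l]
  ring

theorem hess_FBCD_add_self {N : ℕ} (η ζ : ℝ) {Λ : ℝ} (hΛ : 0 < Λ) (a : Fin N → Fin N → ℝ)
    {x : Fin N → ℝ} (hx : x ∈ cone N) (k : Fin N) :
    hess (fun w => FBCD N η ζ Λ w + ∑ p : Fin N, ∑ q : Fin N, a p q * w p * w q) k k x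
      = ∑ m ∈ univ.erase k, Real.log |x k ^ 2 - x m ^ 2| + ((N : ℝ) - 1) * (3 - 2 * Real.log Λ)
        + η * (2 * (Real.log (x k) - Real.log Λ) + 3) + 2 * ζ + 2 * a k k := by
  have hN : ((univ.erase k).card : ℝ) = (N : ℝ) - 1 := by
    rw [Finset.cast_card_erase_of_mem (Finset.mem_univ k), Finset.card_fin]
  have hterm : ∀ m ∈ univ.erase k, 2 * Real.log ((x k - x m) / Λ) + 3
      + (2 * Real.log ((x k + x m) / Λ) + 3)
      = 2 * (Real.log |x k ^ 2 - x m ^ 2| + (3 - 2 * Real.log Λ)) := by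
    intro m hm
    have hsub := cone_sub_ne_zero hx (Finset.ne_of_mem_erase hm).symm
    have hadd := cone_add_ne_zero hx k m
    rw [Real.log_div hsub hΛ.ne', Real.log_div hadd hΛ.ne', Real.log_abs, sq_sub_sq,
      Real.log_mul hadd hsub]
    ring
  rw [hess_FBCD_add η ζ hΛ a hx, sum_lt_delta_self
    (A := fun i j => 2 * Real.log ((x i - x j) / Λ) + 3)
    (B := fun i j => 2 * Real.log ((x i + x j) / Λ) + 3)
    (fun i j => by rw [log_sub_div_comm]) (fun i j => by rw [add_comm (x j)]),
    Finset.sum_congr rfl hterm, ← Finset.mul_sum, Finset.sum_add_distrib, Finset.sum_const,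
    nsmul_eq_mul, hN]
  simp [mul_add, Finset.sum_add_distrib, Real.log_div (hx.2 k).ne' hΛ.ne']
  ring

theorem coth_half (t : ℝ) : coth (t / 2) = (Real.exp t + 1) / (Real.exp t - 1) := by
  have h : Real.exp t = Real.exp (t / 2) * Real.exp (t / 2) := by
    rw [← Real.exp_add, add_halves]
  rw [coth, Real.cosh_eq, Real.sinh_eq, h, Real.exp_neg, div_div_div_cancel_right₀ two_ne_zero]
  have := Real.exp_pos (t / 2)
  rw [← mul_div_mul_left (_ + _) (_ - _) this.ne']
  congr 1 <;> field_simp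

/-- Coth of half of a shifted logarithm, with the shift expressed through `tanh`. -/
theorem coth_half_log_add {p q : ℝ} (hq : 0 < q) (hpq : q < p) (b : ℝ) :
    coth ((Real.log ((p + q) / |p - q|) + 2 * b) / 2)
      = (p + Real.tanh b * q) / (q + Real.tanh b * p) := by
  have hp : 0 < p - q := sub_pos.2 hpq
  have hs : 0 < p + q := by linarith
  have hb : Real.exp (2 * b) = Real.exp b * Real.exp b := by
    rw [← Real.exp_add, two_mul]
  have he := Real.exp_pos b
  rw [coth_half, Real.exp_add, Real.exp_log (by rw [abs_of_pos hp]; positivity), abs_of_pos hp,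
    Real.tanh_eq, hb, Real.exp_neg]
  have h1 : ((p + q) / (p - q) * (Real.exp b * Real.exp b) + 1)
      = ((p + q) * Real.exp b ^ 2 + (p - q)) / (p - q) := by
    field_simp
  have h2 : ((p + q) / (p - q) * (Real.exp b * Real.exp b) - 1)
      = ((p + q) * Real.exp b ^ 2 - (p - q)) / (p - q) := by
    field_simp
  have h3 : (Real.exp b - (Real.exp b)⁻¹) / (Real.exp b + (Real.exp b)⁻¹)
      = (Real.exp b ^ 2 - 1) / (Real.exp b ^ 2 + 1) := by
    field_simp
  rw [h1, h2, h3, div_div_div_cancel_right₀ hp.ne']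
  set E := Real.exp b
  have h4 : p + (E ^ 2 - 1) / (E ^ 2 + 1) * q
      = ((p + q) * E ^ 2 + (p - q)) / (E ^ 2 + 1) := by
    field_simp
    ring
  have h5 : q + (E ^ 2 - 1) / (E ^ 2 + 1) * p
      = ((p + q) * E ^ 2 - (p - q)) / (E ^ 2 + 1) := by
    field_simp
    ring
  rw [h4, h5, div_div_div_cancel_right₀ (by positivity)]

theorem eq_zero_of_coth_identity {s t u z Y D : ℝ} (hz : 0 < z) (hY : z < Y)
    (ht : t ^ 2 < 1)
    (h : ∀ y x : ℝ, Y ≤ y → y + D ≤ x →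
      (x + u * z) * (y + s * x) * (z + t * y) = (x + s * y) * (y + t * z) * (z + u * x)) :
    s = 0 ∧ t = 0 ∧ u = 0 := by
  have hlead : ∀ y, Y ≤ y → s * (z + t * y) = u * (y + t * z) := by
    intro y hy
    have h0 := h y (y + D) hy le_rfl
    have h1 := h y (y + D + 1) hy (by linarith)
    have h2 := h y (y + D + 2) hy (by linarith)
    linear_combination (h0 - 2 * h1 + h2) / 2
  have h0 := hlead Y le_rfl
  have h1 := hlead (Y + 1) (by linarith)
  have hst : u = s * t := by linear_combination h0 - h1
  have hsu : s = u * t := by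
    refine mul_right_cancel₀ hz.ne' ?_
    linear_combination h0 + Y * hst
  have hs : s = 0 := by
    have : s * (1 - t ^ 2) = 0 := by rw [hst] at hsu; linear_combination hsu
    exact (mul_eq_zero.1 this).resolve_right (by linarith)
  have hu : u = 0 := by rw [hst, hs, zero_mul]
  have h3 := h Y (Y + D) le_rfl le_rfl
  have h4 := h Y (Y + D + 1) le_rfl (by linarith)
  have htz : t * (Y ^ 2 - z ^ 2) = 0 := by
    subst hs hu
    linear_combination h4 - h3
  refine ⟨hs, (mul_eq_zero.1 htz).resolve_right ?_, hu⟩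
  nlinarith

/-- Shifts of the staircase point of the cone. -/
theorem staircase_mem_cone {N : ℕ} (i j : Fin N) {P Q : ℝ} (hP : 0 ≤ P) (hQ : 0 ≤ Q) :
    (fun m : Fin N => (N : ℝ) - m + (if m ≤ j then P else 0) + (if m ≤ i then Q else 0))
      ∈ cone N := by
  constructor
  · intro m n hmn
    have hc : ((m : ℕ) : ℝ) < (n : ℕ) := by exact_mod_cast hmn
    have h1 : (if n ≤ j then P else 0) ≤ (if m ≤ j then P else 0) := by grind
    have h2 : (if n ≤ i then Q else 0) ≤ (if m ≤ i then Q else 0) := by grind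
    simp only
    linarith
  · intro m
    have hc : ((m : ℕ) : ℝ) < N := by exact_mod_cast m.2
    have h1 : 0 ≤ (if m ≤ j then P else 0) := by split_ifs <;> simp [hP]
    have h2 : 0 ≤ (if m ≤ i then Q else 0) := by split_ifs <;> simp [hQ]
    simp only
    linarith

theorem eq_zero_of_bcdReduction_of_lt {N : ℕ} (η ζ : ℝ) {Λ : ℝ} (hΛ : 0 < Λ)
    {a : Fin N → Fin N → ℝ} (hsym : ∀ i j, a j i = a i j)
    (hred : ∀ x ∈ cone N, bcdReduction η (fun i j =>
      hess (fun w => FBCD N η ζ Λ w + ∑ p : Fin N, ∑ q : Fin N, a p q * w p * w q) i j x))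
    {i j k : Fin N} (hij : i < j) (hjk : j < k) : a i j = 0 ∧ a j k = 0 ∧ a i k = 0 := by
  have hik := hij.trans hjk
  have hcoth : ∀ x ∈ cone N, ∀ p q : Fin N, p < q →
      coth (hess (fun w => FBCD N η ζ Λ w + ∑ p : Fin N, ∑ q : Fin N, a p q * w p * w q) p q x / 2)
        = (x p + Real.tanh (a p q) * x q) / (x q + Real.tanh (a p q) * x p) := by
    intro x hx p q hpq
    rw [hess_FBCD_add_of_ne η ζ hΛ hsym hx hpq.ne, coth_half_log_add (hx.2 q) (hx.1 hpq)]
  have hden : ∀ x ∈ cone N, ∀ p q : Fin N, p < q → x q + Real.tanh (a p q) * x p ≠ 0 := by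
    intro x hx p q hpq h0
    have h1 := ((hred x hx).1 p q hpq.ne).2
    simp only [hcoth x hx p q hpq, h0, div_zero, lt_irrefl] at h1
  have hid : ∀ x ∈ cone N,
      (x i + Real.tanh (a i k) * x k) * (x j + Real.tanh (a i j) * x i)
          * (x k + Real.tanh (a j k) * x j)
        = (x i + Real.tanh (a i j) * x j) * (x j + Real.tanh (a j k) * x k)
          * (x k + Real.tanh (a i k) * x i) := by
    intro x hx
    have h1 := (hred x hx).2.1 i j k hij hjk
    simp only [hcoth x hx _ _ hij, hcoth x hx _ _ hjk, hcoth x hx _ _ hik] at h1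
    rw [div_mul_div_comm, div_eq_div_iff (hden x hx _ _ hik)
      (mul_ne_zero (hden x hx _ _ hij) (hden x hx _ _ hjk))] at h1
    linear_combination h1
  have hkN : ((k : ℕ) : ℝ) < N := by exact_mod_cast k.2
  have hjk' : ((j : ℕ) : ℝ) < (k : ℕ) := by exact_mod_cast hjk
  have hzero := eq_zero_of_coth_identity (s := Real.tanh (a i j)) (t := Real.tanh (a j k))
    (u := Real.tanh (a i k)) (z := (N : ℝ) - k) (Y := (N : ℝ) - j) (D := (j : ℝ) - i)
    (by linarith) (by linarith) (Real.tanh_sq_lt_one _) (by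
      intro y x hy hx
      have h1 := hid _ (staircase_mem_cone i j (P := y - (N - j)) (Q := x - (y + (j - i)))
        (by linarith) (by linarith))
      simp only [hij.le, hij.not_ge, hjk.not_ge, hik.not_ge, le_refl, if_true, if_false] at h1
      ring_nf at h1 ⊢
      exact h1)
  have htanh : ∀ b : ℝ, Real.tanh b = 0 → b = 0 := fun b hb =>
    Real.tanh_injective (hb.trans Real.tanh_zero.symm)
  exact ⟨htanh _ hzero.1, htanh _ hzero.2.1, htanh _ hzero.2.2⟩

theorem sinh_log_add_div_abs_sub {p q : ℝ} (hp : 0 < p) (hq : 0 < q) (hpq : p - q ≠ 0) :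
    Real.sinh (Real.log ((p + q) / |p - q|)) = 2 * p * q / |p ^ 2 - q ^ 2| := by
  have habs := abs_pos.2 hpq
  have h2 : |p - q| ^ 2 = (p - q) ^ 2 := sq_abs _
  rw [Real.sinh_log (by positivity), sq_sub_sq, abs_mul, abs_of_pos (add_pos hp hq), inv_div,
    div_sub_div _ _ habs.ne' (by positivity), div_div, div_eq_div_iff (by positivity) (by positivity)]
  linear_combination (-(p + q) * |p - q|) * h2

theorem log_prod_sinh {N : ℕ} {x : Fin N → ℝ} (hx : x ∈ cone N) (k : Fin N) :
    Real.log (∏ n ∈ univ.erase k, Real.sinh (Real.log ((x k + x n) / |x k - x n|)))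
      = ((N : ℝ) - 1) * (Real.log 2 + Real.log (x k)) + (∑ n, Real.log (x n) - Real.log (x k))
        - ∑ n ∈ univ.erase k, Real.log |x k ^ 2 - x n ^ 2| := by
  have hne : ∀ n ∈ univ.erase k, |x k ^ 2 - x n ^ 2| ≠ 0 := by
    intro n hn
    rw [sq_sub_sq]
    exact abs_ne_zero.2 (mul_ne_zero (cone_add_ne_zero hx k n)
      (cone_sub_ne_zero hx (Finset.ne_of_mem_erase hn).symm))
  have hterm : ∀ n ∈ univ.erase k, Real.sinh (Real.log ((x k + x n) / |x k - x n|))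
      = 2 * x k * x n / |x k ^ 2 - x n ^ 2| := fun n hn =>
    sinh_log_add_div_abs_sub (hx.2 k) (hx.2 n)
      (cone_sub_ne_zero hx (Finset.ne_of_mem_erase hn).symm)
  have hnum : ∀ n, 2 * x k * x n ≠ 0 := fun n =>
    mul_ne_zero (mul_ne_zero two_ne_zero (hx.2 k).ne') (hx.2 n).ne'
  have hlog : ∀ n ∈ univ.erase k, Real.log (2 * x k * x n / |x k ^ 2 - x n ^ 2|)
      = (Real.log 2 + Real.log (x k)) + Real.log (x n) - Real.log |x k ^ 2 - x n ^ 2| := by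
    intro n hn
    rw [Real.log_div (hnum n) (hne n hn),
      Real.log_mul (mul_ne_zero two_ne_zero (hx.2 k).ne') (hx.2 n).ne',
      Real.log_mul two_ne_zero (hx.2 k).ne']
  rw [Finset.prod_congr rfl hterm,
    Real.log_prod fun n hn => div_ne_zero (hnum n) (hne n hn), Finset.sum_congr rfl hlog,
    Finset.sum_sub_distrib, Finset.sum_add_distrib, Finset.sum_const, nsmul_eq_mul,
    Finset.cast_card_erase_of_mem (Finset.mem_univ k), Finset.card_fin,
    Finset.sum_erase_eq_sub (Finset.mem_univ k)]

theorem prod_sinh_pos {N : ℕ} {x : Fin N → ℝ} (hx : x ∈ cone N) (k : Fin N) :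
    0 < ∏ n ∈ univ.erase k, Real.sinh (Real.log ((x k + x n) / |x k - x n|)) := by
  refine Finset.prod_pos fun n hn => ?_
  have hsub := cone_sub_ne_zero hx (Finset.ne_of_mem_erase hn).symm
  have hk := hx.2 k
  have hn := hx.2 n
  rw [sinh_log_add_div_abs_sub hk hn hsub]
  refine div_pos (by positivity) (abs_pos.2 ?_)
  rw [sq_sub_sq]
  exact mul_ne_zero (cone_add_ne_zero hx k n) hsub

theorem diag_eq_of_bcdReduction {N : ℕ} (η ζ : ℝ) {Λ : ℝ} (hΛ : 0 < Λ)
    {a : Fin N → Fin N → ℝ} (hsym : ∀ i j, a j i = a i j) (hoff : ∀ i j, i ≠ j → a i j = 0)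
    {x : Fin N → ℝ} (hx : x ∈ cone N) (hred : bcdReduction η (fun i j =>
      hess (fun w => FBCD N η ζ Λ w + ∑ p : Fin N, ∑ q : Fin N, a p q * w p * w q) i j x))
    {i j : Fin N} (hij : i < j) : a i i = a j j := by
  have hprod : ∀ k : Fin N, (∏ n ∈ univ.erase k, Real.sinh
      (hess (fun w => FBCD N η ζ Λ w + ∑ p : Fin N, ∑ q : Fin N, a p q * w p * w q) k n x))
      = ∏ n ∈ univ.erase k, Real.sinh (Real.log ((x k + x n) / |x k - x n|)) := by
    intro k
    refine Finset.prod_congr rfl fun n hn => ?_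
    have hkn := (Finset.ne_of_mem_erase hn).symm
    rw [hess_FBCD_add_of_ne η ζ hΛ hsym hx hkn, hoff k n hkn, mul_zero, add_zero]
  have hcoth : coth (hess (fun w => FBCD N η ζ Λ w
      + ∑ p : Fin N, ∑ q : Fin N, a p q * w p * w q) i j x / 2) = x i / x j := by
    rw [hess_FBCD_add_of_ne η ζ hΛ hsym hx hij.ne, coth_half_log_add (hx.2 j) (hx.1 hij),
      hoff i j hij.ne, Real.tanh_zero, zero_mul, zero_mul, add_zero, add_zero]
  have hxi := hx.2 i
  have hxj := hx.2 j
  have h := congrArg Real.log (hred.2.2 i j hij)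
  simp only [hprod, hcoth] at h
  rw [Real.log_exp, Real.log_mul (Real.rpow_pos_of_pos (div_pos hxi hxj) _).ne'
      (div_pos (prod_sinh_pos hx j) (prod_sinh_pos hx i)).ne', Real.log_rpow (div_pos hxi hxj),
    Real.log_div hxi.ne' hxj.ne', Real.log_div (prod_sinh_pos hx j).ne' (prod_sinh_pos hx i).ne',
    log_prod_sinh hx, log_prod_sinh hx, hess_FBCD_add_self η ζ hΛ a hx,
    hess_FBCD_add_self η ζ hΛ a hx] at h
  linear_combination h / 2

/-- if adding a quadratic form `Q(x) = ∑ a_{ij} x_i x_j` to the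
BCD-type prepotential (with `Λ = e^{(6(N-1+η)+4ζ)/(4(N-1+η))}`) preserves the
BCD-type reduction with parameter `η`, then `a_{ij} = 0` off the diagonal and
`a_{ii} = ξ` for some constant `ξ`. -/
theorem bcd_reduction_quadratic (N : ℕ) (hN : 3 ≤ N) (η ζ : ℝ) (hη : 0 ≤ η)
    (a : Fin N → Fin N → ℝ) (hsym : ∀ i j : Fin N, a j i = a i j)
    (hred : ∀ x ∈ cone N, bcdReduction η (fun i j =>
      hess (fun w =>
          FBCD N η ζ (Real.exp ((6*((N : ℝ) - 1 + η) + 4*ζ) / (4*((N : ℝ) - 1 + η)))) w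
          + ∑ p : Fin N, ∑ q : Fin N, a p q * w p * w q) i j x)) :
    (∀ i j : Fin N, i ≠ j → a i j = 0) ∧ (∃ ξ : ℝ, ∀ i : Fin N, a i i = ξ) := by
  have hoff_lt : ∀ i j : Fin N, i < j → a i j = 0 := by
    intro i j hij
    obtain ⟨k, hki, hkj⟩ : ∃ k : Fin N, k ≠ i ∧ k ≠ j := by
      by_contra! hne
      have h0 := hne ⟨0, by omega⟩
      have h1 := hne ⟨1, by omega⟩
      have h2 := hne ⟨2, by omega⟩
      simp only [ne_eq, Fin.ext_iff] at h0 h1 h2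
      omega
    rcases lt_or_gt_of_ne hki with hk | hk
    · exact (eq_zero_of_bcdReduction_of_lt η ζ (Real.exp_pos _) hsym hred hk hij).2.1
    rcases lt_or_gt_of_ne hkj with hk' | hk'
    · exact (eq_zero_of_bcdReduction_of_lt η ζ (Real.exp_pos _) hsym hred hk hk').2.2
    · exact (eq_zero_of_bcdReduction_of_lt η ζ (Real.exp_pos _) hsym hred hij hk').1
  have hoff : ∀ i j : Fin N, i ≠ j → a i j = 0 := by
    intro i j hij
    rcases lt_or_gt_of_ne hij with h | h
    · exact hoff_lt i j h
    · rw [hsym j i]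
      exact hoff_lt j i h
  refine ⟨hoff, a ⟨0, by omega⟩ ⟨0, by omega⟩, fun i => ?_⟩
  rcases Nat.eq_zero_or_pos i with hi | hi
  · rw [Fin.ext (b := ⟨0, by omega⟩) hi]
  · have hx := staircase_mem_cone i i le_rfl le_rfl
    exact (diag_eq_of_bcdReduction η ζ (Real.exp_pos _) hsym hoff hx (hred _ hx)
      (i := ⟨0, by omega⟩) hi).symm
end
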